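/- Let C ⊆ PΠ_{n,2} be a split closed order ideal and let D ⊆ Fin n be disconnected with respect to C. Then the set {π ∈ C : |π| = D} has a greatest element γ: γ ∈ C, |γ| = D, and σ ≤ γ for every σ ∈ C with |σ| = D. Moreover every block B of γ is a maximal connected subset of D: B is connected with respect to C, and every set B' with B ⊊ B' ⊆ D is disconnected with respect to C. -/

import Mathlib

/-- A partial set partition of `Fin n`: a finite set of nonempty, pairwise disjoint
subsets of `Fin n`, called its blocks. -/
structure PartialSetPartition (n : ℕ) where
  blocks : Finset (Finset (Fin n))
  nonempty_of_mem : ∀ B ∈ blocks, B.Nonempty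
  disjoint_of_ne : ∀ B ∈ blocks, ∀ B' ∈ blocks, B ≠ B' → Disjoint B B'

namespace PartialSetPartition

variable {n : ℕ}

/-- The ground set `|π|` of a partial set partition: the union of its blocks. -/
def ground (π : PartialSetPartition n) : Finset (Fin n) := π.blocks.sup id

/-- The order on `PΠ_n`: `τ ≤ π` iff `|τ| ⊆ |π|` and every nonempty set of the form
`P ∩ |τ|`, with `P` a block of `π`, is contained in some block of `τ`. -/
def Le (τ π : PartialSetPartition n) : Prop :=
  τ.ground ⊆ π.ground ∧
    ∀ P ∈ π.blocks, (P ∩ τ.ground).Nonempty → ∃ B ∈ τ.blocks, P ∩ τ.ground ⊆ B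

/-- Membership in `PΠ_{n,2}`: at least two blocks. -/
def TwoBlocks (π : PartialSetPartition n) : Prop := 2 ≤ π.blocks.card

/-- `ρ` is the splitting `π^τ` of `π` by the two-block partial set partition `τ`:
some block `B` of `π` equals the union of the two blocks of `τ` (i.e. `|τ|`), and `ρ` is
obtained from `π` by replacing `B` with the two blocks of `τ`. -/
def IsSplitting (π τ ρ : PartialSetPartition n) : Prop :=
  τ.blocks.card = 2 ∧
    ∃ B ∈ π.blocks, B = τ.ground ∧ ρ.blocks = (π.blocks.erase B) ∪ τ.blocks

/-- A split closed order ideal: a subset of `PΠ_{n,2}` that is downward closed for the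
order on `PΠ_n` and closed under splittings. -/
def IsSplitClosedIdeal (C : Set (PartialSetPartition n)) : Prop :=
  (∀ π ∈ C, TwoBlocks π) ∧
    (∀ π ∈ C, ∀ τ, TwoBlocks τ → Le τ π → τ ∈ C) ∧
    (∀ π ∈ C, ∀ τ ∈ C, ∀ ρ, IsSplitting π τ ρ → ρ ∈ C)

end PartialSetPartition

namespace PartialSetPartition

/-- A nonempty set `D` is disconnected with respect to `C` if `D` is the ground set of
some element of `C`. -/
def Disconnected {n : ℕ} (C : Set (PartialSetPartition n)) (D : Finset (Fin n)) : Prop :=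
  ∃ π ∈ C, π.ground = D

end PartialSetPartition

namespace PartialSetPartition

theorem mem_ground {n : ℕ} {π : PartialSetPartition n} {x : Fin n} :
    x ∈ π.ground ↔ ∃ B ∈ π.blocks, x ∈ B := by
  simp [ground, Finset.mem_sup]

theorem subset_ground {n : ℕ} {π : PartialSetPartition n} {B : Finset (Fin n)}
    (hB : B ∈ π.blocks) : B ⊆ π.ground :=
  fun _ hx => mem_ground.2 ⟨B, hB, hx⟩

theorem blocks_injective {n : ℕ} :
    Function.Injective (blocks : PartialSetPartition n → Finset (Finset (Fin n))) := by
  rintro ⟨a, _, _⟩ ⟨b, _, _⟩ h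
  cases h
  rfl

instance {n : ℕ} : Finite (PartialSetPartition n) :=
  Finite.of_injective _ blocks_injective

theorem eq_of_subset {n : ℕ} {π : PartialSetPartition n} {B B' : Finset (Fin n)}
    (hB : B ∈ π.blocks) (hB' : B' ∈ π.blocks) (h : B ⊆ B') : B = B' := by
  by_contra hne
  have := π.disjoint_of_ne B hB B' hB' hne
  obtain ⟨x, hx⟩ := π.nonempty_of_mem B hB
  exact Finset.disjoint_left.1 this hx (h hx)

/-- A partial set partition with at least two blocks has no block containing its ground set. -/
theorem TwoBlocks.not_ground_subset {n : ℕ} {π : PartialSetPartition n} (h : TwoBlocks π)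
    {B : Finset (Fin n)} (hB : B ∈ π.blocks) : ¬ π.ground ⊆ B := by
  intro hsub
  obtain ⟨A, hA, hne⟩ := Finset.exists_mem_ne h B
  exact hne (eq_of_subset hA hB ((subset_ground hA).trans hsub))

theorem TwoBlocks.ground_nonempty {n : ℕ} {π : PartialSetPartition n} (h : TwoBlocks π) :
    π.ground.Nonempty := by
  obtain ⟨B, hB⟩ := Finset.card_pos.1 (lt_of_lt_of_le Nat.zero_lt_two h)
  exact (π.nonempty_of_mem B hB).mono (subset_ground hB)

/-- The two-block partial set partition with two given disjoint nonempty blocks. -/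
def pair {n : ℕ} (A B : Finset (Fin n)) (hA : A.Nonempty) (hB : B.Nonempty)
    (h : Disjoint A B) : PartialSetPartition n where
  blocks := {A, B}
  nonempty_of_mem := by simp [hA, hB]
  disjoint_of_ne := by
    simp only [Finset.mem_insert, Finset.mem_singleton]
    rintro _ (rfl | rfl) _ (rfl | rfl) hne
    exacts [absurd rfl hne, h, h.symm, absurd rfl hne]

/-- A nonempty subset of the ground set of an element of `C` that lies in no single block
is the ground set of a two-block element of `C`. -/
theorem IsSplitClosedIdeal.exists_pair {n : ℕ} {C : Set (PartialSetPartition n)}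
    (hC : IsSplitClosedIdeal C) {π : PartialSetPartition n} (hπ : π ∈ C)
    {S : Finset (Fin n)} (hne : S.Nonempty) (hS : S ⊆ π.ground)
    (hB : ∀ B ∈ π.blocks, ¬ S ⊆ B) :
    ∃ τ ∈ C, τ.blocks.card = 2 ∧ τ.ground = S := by
  obtain ⟨x, hx⟩ := hne
  obtain ⟨B, hBπ, hxB⟩ := mem_ground.1 (hS hx)
  have hdisj : Disjoint (S ∩ B) (S \ B) := by
    rw [Finset.disjoint_left]
    intro y hy hy'
    simp_all
  have h₁ : (S ∩ B).Nonempty := ⟨x, Finset.mem_inter.2 ⟨hx, hxB⟩⟩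
  have h₂ : (S \ B).Nonempty := Finset.sdiff_nonempty.2 (hB B hBπ)
  let τ := pair (S ∩ B) (S \ B) h₁ h₂ hdisj
  have hcard : τ.blocks.card = 2 := Finset.card_pair (hdisj.ne h₁.ne_empty)
  have hground : τ.ground = S := by
    ext y
    simp only [mem_ground, τ, pair, Finset.mem_insert, Finset.mem_singleton, exists_eq_or_imp,
      exists_eq_left, Finset.mem_inter, Finset.mem_sdiff]
    tauto
  refine ⟨τ, hC.2.1 π hπ τ hcard.ge ⟨hground.trans_subset hS, ?_⟩, hcard, hground⟩
  intro P hP _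
  rw [hground]
  by_cases hPB : P = B
  · exact ⟨S ∩ B, by simp [τ, pair], by rw [hPB, Finset.inter_comm]⟩
  · refine ⟨S \ B, by simp [τ, pair], fun y hy => ?_⟩
    obtain ⟨hyP, hyS⟩ := Finset.mem_inter.1 hy
    exact Finset.mem_sdiff.2
      ⟨hyS, Finset.disjoint_left.1 (π.disjoint_of_ne P hP B hBπ hPB) hyP⟩

/-- A block of `π` which is the ground set of a two-block `τ` can be split by `τ`. -/
theorem exists_isSplitting {n : ℕ} {π τ : PartialSetPartition n} (hτ : τ.blocks.card = 2)
    (hB : τ.ground ∈ π.blocks) :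
    ∃ ρ, IsSplitting π τ ρ ∧ ρ.ground = π.ground ∧ π.blocks.card < ρ.blocks.card := by
  have hd : ∀ A ∈ π.blocks.erase τ.ground, ∀ T ∈ τ.blocks, Disjoint A T := by
    intro A hA T hT
    obtain ⟨hne, hA⟩ := Finset.mem_erase.1 hA
    exact (π.disjoint_of_ne A hA _ hB hne).mono_right (subset_ground hT)
  let ρ : PartialSetPartition n :=
    { blocks := π.blocks.erase τ.ground ∪ τ.blocks
      nonempty_of_mem := by
        intro A hA
        rcases Finset.mem_union.1 hA with hA | hA
        · exact π.nonempty_of_mem A (Finset.mem_of_mem_erase hA)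
        · exact τ.nonempty_of_mem A hA
      disjoint_of_ne := by
        intro A hA A' hA' hne
        rcases Finset.mem_union.1 hA with hA | hA <;> rcases Finset.mem_union.1 hA' with hA' | hA'
        · exact π.disjoint_of_ne A (Finset.mem_of_mem_erase hA) A'
            (Finset.mem_of_mem_erase hA') hne
        · exact hd A hA A' hA'
        · exact (hd A' hA' A hA).symm
        · exact τ.disjoint_of_ne A hA A' hA' hne }
  refine ⟨ρ, ⟨hτ, τ.ground, hB, rfl, rfl⟩, ?_, ?_⟩
  · calc ρ.ground = (π.blocks.erase τ.ground).sup id ∪ τ.ground := Finset.sup_union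
      _ = (insert τ.ground (π.blocks.erase τ.ground)).sup id := by
        rw [Finset.sup_insert, Finset.union_comm]; rfl
      _ = π.ground := by rw [Finset.insert_erase hB]; rfl
  · have hdisj : Disjoint (π.blocks.erase τ.ground) τ.blocks := by
      rw [Finset.disjoint_left]
      intro A hA hA'
      exact (τ.nonempty_of_mem A hA').ne_empty (disjoint_self.1 (hd A hA A hA'))
    have h₁ : ρ.blocks.card = (π.blocks.erase τ.ground).card + τ.blocks.card :=
      Finset.card_union_of_disjoint hdisj
    have h₂ := Finset.card_erase_add_one hB
    omega

end PartialSetPartition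

open PartialSetPartition in
/-- If `D` is disconnected with respect to a split closed order ideal `C`, then the set
of elements of `C` with ground set `D` has a greatest element `γ`, and every block of `γ`
is a maximal connected subset of `D`. -/
theorem exists_greatest_with_ground
    {n : ℕ} (C : Set (PartialSetPartition n)) (hC : IsSplitClosedIdeal C)
    (D : Finset (Fin n)) (hD : Disconnected C D) :
    ∃ γ : PartialSetPartition n, γ ∈ C ∧ γ.ground = D ∧
      (∀ σ ∈ C, σ.ground = D → Le σ γ) ∧
      ∀ B ∈ γ.blocks,
        (B.Nonempty ∧ ¬ Disconnected C B) ∧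
        ∀ B' : Finset (Fin n), B ⊂ B' → B' ⊆ D → Disconnected C B' := by
  obtain ⟨π, hπ, hπD⟩ := hD
  obtain ⟨γ, ⟨hγ, hγD⟩, hmax⟩ := Set.exists_max_image {σ | σ ∈ C ∧ σ.ground = D}
    (fun σ => σ.blocks.card) (Set.toFinite _) ⟨π, hπ, hπD⟩
  have hconn : ∀ B ∈ γ.blocks, ¬ Disconnected C B := by
    rintro B hB ⟨σ, hσ, rfl⟩
    have hσ₂ := hC.1 σ hσ
    obtain ⟨τ, hτ, hcard, hground⟩ := hC.exists_pair hσ hσ₂.ground_nonempty subset_rfl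
      fun _ hA => hσ₂.not_ground_subset hA
    rw [← hground] at hB
    obtain ⟨ρ, hsplit, hρ, hlt⟩ := exists_isSplitting hcard hB
    exact hlt.not_ge (hmax ρ ⟨hC.2.2 γ hγ τ hτ ρ hsplit, hρ.trans hγD⟩)
  refine ⟨γ, hγ, hγD, ?_, fun B hB => ⟨⟨γ.nonempty_of_mem B hB, hconn B hB⟩, ?_⟩⟩
  · intro σ hσ hσD
    refine ⟨(hσD.trans hγD.symm).subset, fun P hP hne => ?_⟩
    by_contra! hcon
    obtain ⟨τ, hτ, -, hground⟩ := hC.exists_pair hσ hne Finset.inter_subset_right hcon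
    refine hconn P hP ⟨τ, hτ, hground.trans (Finset.inter_eq_left.2 ?_)⟩
    rw [hσD, ← hγD]
    exact subset_ground hP
  · intro B' hBB' hB'D
    obtain ⟨τ, hτ, -, hground⟩ := hC.exists_pair hγ
      ((γ.nonempty_of_mem B hB).mono hBB'.subset) (hB'D.trans hγD.symm.subset)
      fun A hA hsub => hBB'.not_subset
        (hsub.trans (eq_of_subset hB hA (hBB'.subset.trans hsub)).symm.subset)
    exact ⟨τ, hτ, hground⟩
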